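/- The lead term algebra of F[V]^{SL2(F_p)}, i.e. the F-subalgebra of F[V] generated by the lead monomials LM(f) of all nonzero f ∈ F[V]^{SL2(F_p)} with respect to the graded reverse lexicographic order with a0 < a1 < a2 < a3, is not a finitely generated F-algebra; equivalently, F[V]^{SL2(F_p)} has no finite SAGBI basis with respect to this order. -/

import Mathlib

open MvPolynomial

noncomputable section

/-- The right action of the 2×2 matrix `g` over `F_p` on `F[V] = F[a₃,a₂,a₁,a₀]`
(with `aᵢ = X i`), given by the dual of the third symmetric power representation. -/
def act (p : ℕ) [Fact p.Prime] (F : Type) [Field F] [CharP F p]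
    (g : Matrix (Fin 2) (Fin 2) (ZMod p)) :
    MvPolynomial (Fin 4) F →ₐ[F] MvPolynomial (Fin 4) F :=
  letI c : ZMod p → MvPolynomial (Fin 4) F := fun x => C (ZMod.castHom (dvd_refl p) F x)
  letI al := c (g 0 0)
  letI be := c (g 0 1)
  letI ga := c (g 1 0)
  letI de := c (g 1 1)
  aeval ![
    de ^ 3 * X 0 + 3 * de ^ 2 * ga * X 1 + 3 * de * ga ^ 2 * X 2 + ga ^ 3 * X 3,
    de ^ 2 * be * X 0 + (de ^ 2 * al + 2 * de * be * ga) * X 1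
      + (2 * de * ga * al + be * ga ^ 2) * X 2 + ga ^ 2 * al * X 3,
    de * be ^ 2 * X 0 + (2 * de * be * al + be ^ 2 * ga) * X 1
      + (de * al ^ 2 + 2 * be * ga * al) * X 2 + ga * al ^ 2 * X 3,
    be ^ 3 * X 0 + 3 * be ^ 2 * al * X 1 + 3 * be * al ^ 2 * X 2 + al ^ 3 * X 3]

/-- The transfer with respect to the Sylow `p`-subgroup `P = ⟨σ⟩`,
`tr^P(f) = ∑_{τ ∈ P} (f)τ`, where the elements of `P` are the matrices `[[1,s],[0,1]]`. -/
def trP (p : ℕ) [Fact p.Prime] (F : Type) [Field F] [CharP F p]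
    (f : MvPolynomial (Fin 4) F) : MvPolynomial (Fin 4) F :=
  ∑ s : ZMod p, act p F !![1, s; 0, 1] f

/-- The relative transfer `tr_B^G(f) = ∑_{τ ∈ Q ∪ {η}} (f)τ`, using the coset
representatives `Q ∪ {η}` of the Borel subgroup `B` in `G = SL₂(F_p)`. -/
def trBG (p : ℕ) [Fact p.Prime] (F : Type) [Field F] [CharP F p]
    (f : MvPolynomial (Fin 4) F) : MvPolynomial (Fin 4) F :=
  (∑ s : ZMod p, act p F !![1, 0; s, 1] f) + act p F !![0, 1; -1, 0] f

/-- The full transfer `tr^G(f) = ∑_{τ ∈ SL₂(F_p)} (f)τ`. -/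
def trG (p : ℕ) [Fact p.Prime] (F : Type) [Field F] [CharP F p]
    (f : MvPolynomial (Fin 4) F) : MvPolynomial (Fin 4) F :=
  ∑ g : Matrix.SpecialLinearGroup (Fin 2) (ZMod p), act p F g.1 f

/-- `N = ∏_{τ ∈ P} (a₃)τ = ∏_{s ∈ F_p} (a₃ + 3s a₂ + 3s² a₁ + s³ a₀)`. -/
def Npoly (p : ℕ) [Fact p.Prime] (F : Type) [Field F] [CharP F p] :
    MvPolynomial (Fin 4) F :=
  ∏ s : ZMod p, act p F !![1, s; 0, 1] (X 3)

/-- The weight of the monomial `a₃^e₃ a₂^e₂ a₁^e₁ a₀^e₀`, i.e. `3e₃ + e₂ - e₁ - 3e₀`. -/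
def wt (d : Fin 4 →₀ ℕ) : ℤ :=
  3 * (d 3 : ℤ) + (d 2 : ℤ) - (d 1 : ℤ) - 3 * (d 0 : ℤ)

/-- `f` is isobaric of weight `lam` modulo `p - 1`: every monomial occurring in `f`
has weight congruent to `lam` modulo `p - 1`. -/
def Isobaric (p : ℕ) {F : Type} [Field F] (f : MvPolynomial (Fin 4) F) (lam : ℤ) : Prop :=
  ∀ d ∈ f.support, ((p : ℤ) - 1) ∣ (wt d - lam)

/-- Strict grevlex comparison on exponent vectors, for the graded reverse
lexicographic order with `a₀ < a₁ < a₂ < a₃`. -/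
def grevlexLt (d e : Fin 4 →₀ ℕ) : Prop :=
  (∑ i : Fin 4, d i) < (∑ i : Fin 4, e i) ∨
    ((∑ i : Fin 4, d i) = (∑ i : Fin 4, e i) ∧
      ∃ k : Fin 4, e k < d k ∧ ∀ j : Fin 4, j < k → d j = e j)

/-- `d` is the lead monomial of `f` in the grevlex order with `a₀ < a₁ < a₂ < a₃`. -/
def LeadMonomialIs {F : Type} [Field F] (f : MvPolynomial (Fin 4) F) (d : Fin 4 →₀ ℕ) : Prop :=
  coeff d f ≠ 0 ∧ ∀ e ∈ f.support, e ≠ d → grevlexLt e d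

/-- The lead term of `f` is `c · x^d` in the grevlex order with `a₀ < a₁ < a₂ < a₃`. -/
def LeadTermIs {F : Type} [Field F] (f : MvPolynomial (Fin 4) F) (c : F) (d : Fin 4 →₀ ℕ) :
    Prop :=
  LeadMonomialIs f d ∧ coeff d f = c

/-- The discriminant `D` of the binary cubic. -/
def Dpoly (F : Type) [Field F] : MvPolynomial (Fin 4) F :=
  3 * X 2 ^ 2 * X 1 ^ 2 - 4 * X 3 * X 1 ^ 3 - 4 * X 2 ^ 3 * X 0
    + 6 * X 3 * X 2 * X 1 * X 0 - X 3 ^ 2 * X 0 ^ 2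

/-- `K = -tr^G(a₁^{p-1})`. -/
def Kpoly (p : ℕ) [Fact p.Prime] (F : Type) [Field F] [CharP F p] :
    MvPolynomial (Fin 4) F :=
  - trG p F (X 1 ^ (p - 1))

/-- Dickson's invariant `L = 3(a₂^p a₁ - a₂ a₁^p) - (a₃^p a₀ - a₃ a₀^p)`. -/
def Lpoly (p : ℕ) (F : Type) [Field F] : MvPolynomial (Fin 4) F :=
  3 * (X 2 ^ p * X 1 - X 2 * X 1 ^ p) - (X 3 ^ p * X 0 - X 3 * X 0 ^ p)

/-- `e = 2a₁³ + a₀(a₃a₀ - 3a₂a₁)`. -/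
def epoly (F : Type) [Field F] : MvPolynomial (Fin 4) F :=
  2 * X 1 ^ 3 + X 0 * (X 3 * X 0 - 3 * X 2 * X 1)

/-- `d = a₁² - a₂a₀`. -/
def dpoly (F : Type) [Field F] : MvPolynomial (Fin 4) F :=
  X 1 ^ 2 - X 2 * X 0

/-- `ξ = 3a₂² - 4a₃a₁`. -/
def xipoly (F : Type) [Field F] : MvPolynomial (Fin 4) F :=
  3 * X 2 ^ 2 - 4 * X 3 * X 1

/-- The ring of `SL₂(F_p)`-invariants `F[V]^{SL₂(F_p)}`, as a subalgebra of `F[V]`. -/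
def invariants (p : ℕ) [Fact p.Prime] (F : Type) [Field F] [CharP F p] :
    Subalgebra F (MvPolynomial (Fin 4) F) where
  carrier := {f | ∀ g : Matrix.SpecialLinearGroup (Fin 2) (ZMod p), act p F g.1 f = f}
  mul_mem' := fun hf hg g => by rw [map_mul, hf g, hg g]
  one_mem' := fun g => map_one _
  add_mem' := fun hf hg g => by rw [map_add, hf g, hg g]
  zero_mem' := fun g => map_zero _
  algebraMap_mem' := fun c g => (act _ _ _).commutes c

/-! ### The action law -/

lemma act_X0 (p : ℕ) [Fact p.Prime] (F : Type) [Field F] [CharP F p]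
    (g : Matrix (Fin 2) (Fin 2) (ZMod p)) :
    act p F g (X 0) = C (ZMod.castHom (dvd_refl p) F (g 1 1)) ^ 3 * X 0
      + 3 * C (ZMod.castHom (dvd_refl p) F (g 1 1)) ^ 2
          * C (ZMod.castHom (dvd_refl p) F (g 1 0)) * X 1
      + 3 * C (ZMod.castHom (dvd_refl p) F (g 1 1))
          * C (ZMod.castHom (dvd_refl p) F (g 1 0)) ^ 2 * X 2
      + C (ZMod.castHom (dvd_refl p) F (g 1 0)) ^ 3 * X 3 := by
  simp only [act, aeval_X]
  rfl

lemma act_X1 (p : ℕ) [Fact p.Prime] (F : Type) [Field F] [CharP F p]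
    (g : Matrix (Fin 2) (Fin 2) (ZMod p)) :
    act p F g (X 1) =
      C (ZMod.castHom (dvd_refl p) F (g 1 1)) ^ 2 * C (ZMod.castHom (dvd_refl p) F (g 0 1)) * X 0
      + (C (ZMod.castHom (dvd_refl p) F (g 1 1)) ^ 2 * C (ZMod.castHom (dvd_refl p) F (g 0 0))
        + 2 * C (ZMod.castHom (dvd_refl p) F (g 1 1)) * C (ZMod.castHom (dvd_refl p) F (g 0 1))
          * C (ZMod.castHom (dvd_refl p) F (g 1 0))) * X 1
      + (2 * C (ZMod.castHom (dvd_refl p) F (g 1 1)) * C (ZMod.castHom (dvd_refl p) F (g 1 0))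
          * C (ZMod.castHom (dvd_refl p) F (g 0 0))
        + C (ZMod.castHom (dvd_refl p) F (g 0 1))
          * C (ZMod.castHom (dvd_refl p) F (g 1 0)) ^ 2) * X 2
      + C (ZMod.castHom (dvd_refl p) F (g 1 0)) ^ 2
          * C (ZMod.castHom (dvd_refl p) F (g 0 0)) * X 3 := by
  simp only [act, aeval_X]
  rfl

lemma act_X2 (p : ℕ) [Fact p.Prime] (F : Type) [Field F] [CharP F p]
    (g : Matrix (Fin 2) (Fin 2) (ZMod p)) :
    act p F g (X 2) =
      C (ZMod.castHom (dvd_refl p) F (g 1 1)) * C (ZMod.castHom (dvd_refl p) F (g 0 1)) ^ 2 * X 0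
      + (2 * C (ZMod.castHom (dvd_refl p) F (g 1 1)) * C (ZMod.castHom (dvd_refl p) F (g 0 1))
          * C (ZMod.castHom (dvd_refl p) F (g 0 0))
        + C (ZMod.castHom (dvd_refl p) F (g 0 1)) ^ 2
          * C (ZMod.castHom (dvd_refl p) F (g 1 0))) * X 1
      + (C (ZMod.castHom (dvd_refl p) F (g 1 1)) * C (ZMod.castHom (dvd_refl p) F (g 0 0)) ^ 2
        + 2 * C (ZMod.castHom (dvd_refl p) F (g 0 1)) * C (ZMod.castHom (dvd_refl p) F (g 1 0))
          * C (ZMod.castHom (dvd_refl p) F (g 0 0))) * X 2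
      + C (ZMod.castHom (dvd_refl p) F (g 1 0))
          * C (ZMod.castHom (dvd_refl p) F (g 0 0)) ^ 2 * X 3 := by
  simp only [act, aeval_X]
  rfl

lemma act_X3 (p : ℕ) [Fact p.Prime] (F : Type) [Field F] [CharP F p]
    (g : Matrix (Fin 2) (Fin 2) (ZMod p)) :
    act p F g (X 3) = C (ZMod.castHom (dvd_refl p) F (g 0 1)) ^ 3 * X 0
      + 3 * C (ZMod.castHom (dvd_refl p) F (g 0 1)) ^ 2
          * C (ZMod.castHom (dvd_refl p) F (g 0 0)) * X 1
      + 3 * C (ZMod.castHom (dvd_refl p) F (g 0 1))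
          * C (ZMod.castHom (dvd_refl p) F (g 0 0)) ^ 2 * X 2
      + C (ZMod.castHom (dvd_refl p) F (g 0 0)) ^ 3 * X 3 := by
  simp only [act, aeval_X]
  rfl

lemma act_C (p : ℕ) [Fact p.Prime] (F : Type) [Field F] [CharP F p]
    (g : Matrix (Fin 2) (Fin 2) (ZMod p)) (c : F) : act p F g (C c) = C c :=
  (act p F g).commutes c

lemma act_act (p : ℕ) [Fact p.Prime] (F : Type) [Field F] [CharP F p]
    (g h : Matrix (Fin 2) (Fin 2) (ZMod p)) (f : MvPolynomial (Fin 4) F) :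
    act p F g (act p F h f) = act p F (h * g) f := by
  have : (act p F g).comp (act p F h) = act p F (h * g) := by
    apply MvPolynomial.algHom_ext
    intro i
    have h2 : act p F g (2 : MvPolynomial (Fin 4) F) = 2 := map_ofNat _ 2
    have h3 : act p F g (3 : MvPolynomial (Fin 4) F) = 3 := map_ofNat _ 3
    fin_cases i <;>
    · simp only [Fin.zero_eta, Fin.mk_one, Fin.reduceFinMk, AlgHom.comp_apply, act_X0, act_X1,
        act_X2, act_X3, map_add, map_mul, map_pow, act_C, h2, h3, Matrix.mul_apply,
        Fin.sum_univ_two]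
      ring
  exact DFunLike.congr_fun this f

lemma act_one (p : ℕ) [Fact p.Prime] (F : Type) [Field F] [CharP F p]
    (f : MvPolynomial (Fin 4) F) : act p F 1 f = f := by
  have : act p F 1 = AlgHom.id F _ := by
    apply MvPolynomial.algHom_ext
    intro i
    fin_cases i <;>
      simp [act_X0, act_X1, act_X2, act_X3]
  rw [this]; rfl

/-! ### Linear forms in the orbit of `a₃` -/

def Lform (p : ℕ) [Fact p.Prime] (F : Type) [Field F] [CharP F p]
    (v : ZMod p × ZMod p) : MvPolynomial (Fin 4) F :=
  C (ZMod.castHom (dvd_refl p) F v.2) ^ 3 * X 0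
    + 3 * C (ZMod.castHom (dvd_refl p) F v.2) ^ 2 * C (ZMod.castHom (dvd_refl p) F v.1) * X 1
    + 3 * C (ZMod.castHom (dvd_refl p) F v.2) * C (ZMod.castHom (dvd_refl p) F v.1) ^ 2 * X 2
    + C (ZMod.castHom (dvd_refl p) F v.1) ^ 3 * X 3

lemma act_Lform (p : ℕ) [Fact p.Prime] (F : Type) [Field F] [CharP F p]
    (g : Matrix (Fin 2) (Fin 2) (ZMod p)) (v : ZMod p × ZMod p) :
    act p F g (Lform p F v)
      = Lform p F (v.1 * g 0 0 + v.2 * g 1 0, v.1 * g 0 1 + v.2 * g 1 1) := by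
  have h3 : act p F g (3 : MvPolynomial (Fin 4) F) = 3 := map_ofNat _ 3
  simp only [Lform, act_X0, act_X1, act_X2, act_X3, map_add, map_mul, map_pow, act_C, h3]
  ring

def Nset (p : ℕ) [Fact p.Prime] : Finset (ZMod p × ZMod p) :=
  Finset.univ.filter (fun v => v.1 ≠ 0)

def Nprod (p : ℕ) [Fact p.Prime] (F : Type) [Field F] [CharP F p] : MvPolynomial (Fin 4) F :=
  ∏ v ∈ Nset p, Lform p F v

lemma act_Nprod_of_eq (p : ℕ) [Fact p.Prime] (F : Type) [Field F] [CharP F p]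
    (g : Matrix (Fin 2) (Fin 2) (ZMod p)) (h0 : g 1 0 = 0) (hd : g 0 0 * g 1 1 = 1) :
    act p F g (Nprod p F) = Nprod p F := by
  have ha : g 0 0 ≠ 0 := left_ne_zero_of_mul_eq_one hd
  have hb : g 1 1 ≠ 0 := right_ne_zero_of_mul_eq_one hd
  unfold Nprod
  rw [map_prod]
  refine Finset.prod_nbij' (fun v => (v.1 * g 0 0, v.1 * g 0 1 + v.2 * g 1 1))
    (fun v => (v.1 * g 1 1, - (v.1 * g 0 1) + v.2 * g 0 0)) ?_ ?_ ?_ ?_ ?_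
  · intro v hv
    simp only [Nset, Finset.mem_filter, Finset.mem_univ, true_and] at hv ⊢
    exact mul_ne_zero hv ha
  · intro v hv
    simp only [Nset, Finset.mem_filter, Finset.mem_univ, true_and] at hv ⊢
    exact mul_ne_zero hv hb
  · intro v _
    ext
    · simp only; linear_combination v.1 * hd
    · simp only; linear_combination v.2 * hd
  · intro v _
    ext
    · simp only; linear_combination v.1 * hd
    · simp only; linear_combination v.2 * hd
  · intro v _
    rw [act_Lform, h0]
    simp

lemma dvd_act_Nprod (p : ℕ) [Fact p.Prime] (F : Type) [Field F] [CharP F p]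
    (g : Matrix (Fin 2) (Fin 2) (ZMod p)) (h0 : g 1 0 ≠ 0) :
    X 0 ∣ act p F g (Nprod p F) := by
  unfold Nprod
  rw [map_prod]
  refine dvd_trans ?_ (Finset.dvd_prod_of_mem _ (a := (1, - (g 0 0 / g 1 0))) ?_)
  · rw [act_Lform]
    have : (1 : ZMod p) * g 0 0 + -(g 0 0 / g 1 0) * g 1 0 = 0 := by
      field_simp; ring
    simp only [this, Lform, map_zero]
    simp
  · simp [Nset]

lemma act_dpoly (p : ℕ) [Fact p.Prime] (F : Type) [Field F] [CharP F p]
    (g : Matrix (Fin 2) (Fin 2) (ZMod p)) (h0 : g 1 0 = 0) (hd : g 0 0 * g 1 1 = 1) :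
    act p F g (dpoly F) = C (ZMod.castHom (dvd_refl p) F (g 1 1)) ^ 2 * dpoly F := by
  have key : C (ZMod.castHom (dvd_refl p) F (g 0 0)) * C (ZMod.castHom (dvd_refl p) F (g 1 1))
      = (1 : MvPolynomial (Fin 4) F) := by
    rw [← C_mul, ← map_mul, hd, map_one, C_1]
  simp only [dpoly, map_sub, map_mul, map_pow, act_X0, act_X1, act_X2, h0, map_zero]
  linear_combination (X 1 ^ 2 - X 2 * X 0) * C (ZMod.castHom (dvd_refl p) F (g 1 1)) ^ 2 *
    (C (ZMod.castHom (dvd_refl p) F (g 0 0)) * C (ZMod.castHom (dvd_refl p) F (g 1 1)) + 1) * key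

def phi (p : ℕ) [Fact p.Prime] (F : Type) [Field F] [CharP F p] (m : ℕ) :
    MvPolynomial (Fin 4) F :=
  Nprod p F * dpoly F ^ ((p - 1) * m)

lemma act_phi_of_eq (p : ℕ) [Fact p.Prime] (F : Type) [Field F] [CharP F p] (m : ℕ)
    (g : Matrix (Fin 2) (Fin 2) (ZMod p)) (h0 : g 1 0 = 0) (hd : g 0 0 * g 1 1 = 1) :
    act p F g (phi p F m) = phi p F m := by
  have hb : g 1 1 ≠ 0 := right_ne_zero_of_mul_eq_one hd
  rw [phi, map_mul, map_pow, act_Nprod_of_eq p F g h0 hd, act_dpoly p F g h0 hd, mul_pow]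
  have : (C (ZMod.castHom (dvd_refl p) F (g 1 1)) ^ 2) ^ ((p - 1) * m)
      = (1 : MvPolynomial (Fin 4) F) := by
    rw [← pow_mul, ← C_pow, ← map_pow,
      show 2 * ((p - 1) * m) = (p - 1) * (2 * m) by ring, pow_mul,
      ZMod.pow_card_sub_one_eq_one hb, one_pow, map_one, C_1]
  rw [this, one_mul]

/-! ### The invariants -/

open Classical in
def orb (p : ℕ) [Fact p.Prime] (F : Type) [Field F] [CharP F p] (m : ℕ) :
    Finset (MvPolynomial (Fin 4) F) :=
  Finset.univ.image
    (fun g : Matrix.SpecialLinearGroup (Fin 2) (ZMod p) => act p F g.1 (phi p F m))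

def orbSum (p : ℕ) [Fact p.Prime] (F : Type) [Field F] [CharP F p] (m : ℕ) :
    MvPolynomial (Fin 4) F := ∑ x ∈ orb p F m, x

lemma act_mem_orb (p : ℕ) [Fact p.Prime] (F : Type) [Field F] [CharP F p] (m : ℕ)
    (g : Matrix.SpecialLinearGroup (Fin 2) (ZMod p)) (x : MvPolynomial (Fin 4) F)
    (hx : x ∈ orb p F m) : act p F g.1 x ∈ orb p F m := by
  classical
  simp only [orb, Finset.mem_image, Finset.mem_univ, true_and] at hx ⊢
  obtain ⟨h, rfl⟩ := hx
  exact ⟨h * g, by rw [act_act]; rfl⟩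

lemma act_inv_left (p : ℕ) [Fact p.Prime] (F : Type) [Field F] [CharP F p]
    (g : Matrix.SpecialLinearGroup (Fin 2) (ZMod p)) (x : MvPolynomial (Fin 4) F) :
    act p F (g⁻¹).1 (act p F g.1 x) = x := by
  have : g.1 * (g⁻¹).1 = 1 := by
    have h := congrArg Subtype.val (mul_inv_cancel g)
    exact h
  rw [act_act, this, act_one]

lemma orbSum_mem (p : ℕ) [Fact p.Prime] (F : Type) [Field F] [CharP F p] (m : ℕ) :
    orbSum p F m ∈ invariants p F := by
  intro g
  unfold orbSum
  rw [map_sum]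
  refine Finset.sum_nbij' (fun x => act p F g.1 x) (fun x => act p F (g⁻¹).1 x) ?_ ?_ ?_ ?_ ?_
  · exact fun x hx => act_mem_orb p F m g x hx
  · exact fun x hx => act_mem_orb p F m g⁻¹ x hx
  · exact fun x _ => act_inv_left p F g x
  · intro x _
    have := act_inv_left p F g⁻¹ x
    rwa [inv_inv] at this
  · exact fun x _ => rfl

lemma orbSum_eq (p : ℕ) [Fact p.Prime] (F : Type) [Field F] [CharP F p] (m : ℕ) :
    ∃ r, orbSum p F m = phi p F m + X 0 * r := by
  classical
  have hmem : phi p F m ∈ orb p F m := by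
    simp only [orb, Finset.mem_image, Finset.mem_univ, true_and]
    exact ⟨1, act_one p F _⟩
  have hd : X 0 ∣ ∑ x ∈ (orb p F m).erase (phi p F m), x := by
    refine Finset.dvd_sum ?_
    intro x hx
    rw [Finset.mem_erase] at hx
    obtain ⟨hne, hx⟩ := hx
    simp only [orb, Finset.mem_image, Finset.mem_univ, true_and] at hx
    obtain ⟨g, rfl⟩ := hx
    by_cases h0 : g.1 1 0 = 0
    · refine absurd (act_phi_of_eq p F m g.1 h0 ?_) hne
      have := g.2
      rw [Matrix.det_fin_two, h0, mul_zero, sub_zero] at this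
      exact this
    · rw [phi, map_mul]
      exact Dvd.dvd.mul_right (dvd_act_Nprod p F g.1 h0) _
  obtain ⟨r, hr⟩ := hd
  exact ⟨r, by rw [← hr, orbSum, Finset.add_sum_erase _ (fun x => x) hmem]⟩

/-! ### Homogeneity -/

lemma isHomogeneous_CX {F : Type} [Field F] (c : F) (i : Fin 4) :
    (C c * X i : MvPolynomial (Fin 4) F).IsHomogeneous 1 := by
  simpa using (isHomogeneous_C (Fin 4) c).mul (isHomogeneous_X F i)

lemma Lform_eq (p : ℕ) [Fact p.Prime] (F : Type) [Field F] [CharP F p] (v : ZMod p × ZMod p) :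
    ∃ c0 c1 c2 : F, Lform p F v = C c0 * X 0 + C c1 * X 1 + C c2 * X 2
      + C (ZMod.castHom (dvd_refl p) F v.1 ^ 3) * X 3 := by
  refine ⟨ZMod.castHom (dvd_refl p) F v.2 ^ 3,
    3 * ZMod.castHom (dvd_refl p) F v.2 ^ 2 * ZMod.castHom (dvd_refl p) F v.1,
    3 * ZMod.castHom (dvd_refl p) F v.2 * ZMod.castHom (dvd_refl p) F v.1 ^ 2, ?_⟩
  have h3 : (C (3 : F) : MvPolynomial (Fin 4) F) = 3 := map_ofNat C 3
  simp only [Lform, C_mul, C_pow, h3]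

lemma Lform_hom (p : ℕ) [Fact p.Prime] (F : Type) [Field F] [CharP F p] (v : ZMod p × ZMod p) :
    (Lform p F v).IsHomogeneous 1 := by
  obtain ⟨c0, c1, c2, h⟩ := Lform_eq p F v
  rw [h]
  exact (((isHomogeneous_CX _ _).add (isHomogeneous_CX _ _)).add (isHomogeneous_CX _ _)).add
    (isHomogeneous_CX _ _)

lemma dpoly_hom (F : Type) [Field F] : (dpoly F).IsHomogeneous 2 := by
  unfold dpoly
  exact (isHomogeneous_X_pow 1 2).sub ((isHomogeneous_X F 2).mul (isHomogeneous_X F 0))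

lemma act_hom (p : ℕ) [Fact p.Prime] (F : Type) [Field F] [CharP F p]
    (g : Matrix (Fin 2) (Fin 2) (ZMod p)) (f : MvPolynomial (Fin 4) F) (n : ℕ)
    (hf : f.IsHomogeneous n) : (act p F g f).IsHomogeneous n := by
  have hX : ∀ i, (act p F g (X i)).IsHomogeneous 1 := by
    have h2 : (C (2 : F) : MvPolynomial (Fin 4) F) = 2 := map_ofNat C 2
    have h3 : (C (3 : F) : MvPolynomial (Fin 4) F) = 3 := map_ofNat C 3
    intro i
    fin_cases i <;>
    · simp only [Fin.zero_eta, Fin.mk_one, Fin.reduceFinMk, act_X0, act_X1, act_X2, act_X3,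
        ← h2, ← h3, ← C_pow, ← C_mul, ← C_add]
      exact (((isHomogeneous_CX _ _).add (isHomogeneous_CX _ _)).add
        (isHomogeneous_CX _ _)).add (isHomogeneous_CX _ _)
  have := hf.aeval (fun i => act p F g (X i)) hX
  have e : aeval (fun i => act p F g (X i)) = act p F g := by
    apply MvPolynomial.algHom_ext
    intro i
    rw [aeval_X]
  rw [e, one_mul] at this
  exact this

lemma phi_hom (p : ℕ) [Fact p.Prime] (F : Type) [Field F] [CharP F p] (m : ℕ) :
    (phi p F m).IsHomogeneous ((Nset p).card + 2 * ((p - 1) * m)) := by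
  unfold phi
  refine IsHomogeneous.mul ?_ ((dpoly_hom F).pow _)
  have := IsHomogeneous.prod (Nset p) (Lform p F) (fun _ => 1) (fun v _ => Lform_hom p F v)
  simpa [Nprod] using this

lemma orbSum_hom (p : ℕ) [Fact p.Prime] (F : Type) [Field F] [CharP F p] (m : ℕ) :
    (orbSum p F m).IsHomogeneous ((Nset p).card + 2 * ((p - 1) * m)) := by
  classical
  refine IsHomogeneous.sum _ _ _ ?_
  intro x hx
  simp only [orb, Finset.mem_image, Finset.mem_univ, true_and] at hx
  obtain ⟨g, rfl⟩ := hx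
  exact act_hom p F g.1 _ _ (phi_hom p F m)

/-! ### Lead monomials -/

lemma grevlexLt_iff (d e : Fin 4 →₀ ℕ) : grevlexLt d e ↔
    d 0 + d 1 + d 2 + d 3 < e 0 + e 1 + e 2 + e 3 ∨
    (d 0 + d 1 + d 2 + d 3 = e 0 + e 1 + e 2 + e 3 ∧
      (e 0 < d 0 ∨ (d 0 = e 0 ∧ e 1 < d 1) ∨ (d 0 = e 0 ∧ d 1 = e 1 ∧ e 2 < d 2) ∨
        (d 0 = e 0 ∧ d 1 = e 1 ∧ d 2 = e 2 ∧ e 3 < d 3))) := by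
  unfold grevlexLt
  simp only [Fin.sum_univ_four]
  refine or_congr Iff.rfl (and_congr Iff.rfl ?_)
  constructor
  · rintro ⟨k, hk, hj⟩
    fin_cases k
    · exact Or.inl hk
    · exact Or.inr (Or.inl ⟨hj 0 (by decide), hk⟩)
    · exact Or.inr (Or.inr (Or.inl ⟨hj 0 (by decide), hj 1 (by decide), hk⟩))
    · exact Or.inr (Or.inr (Or.inr ⟨hj 0 (by decide), hj 1 (by decide), hj 2 (by decide), hk⟩))
  · rintro (h | ⟨h0, h⟩ | ⟨h0, h1, h⟩ | ⟨h0, h1, h2, h⟩)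
    · exact ⟨0, h, fun j hj => absurd hj (by simp)⟩
    · refine ⟨1, h, fun j hj => ?_⟩
      fin_cases j <;> first | assumption | exact absurd hj (by decide)
    · refine ⟨2, h, fun j hj => ?_⟩
      fin_cases j <;> first | assumption | exact absurd hj (by decide)
    · refine ⟨3, h, fun j hj => ?_⟩
      fin_cases j <;> first | assumption | exact absurd hj (by decide)

lemma grevlexLt_irrefl (d : Fin 4 →₀ ℕ) : ¬ grevlexLt d d := by
  rw [grevlexLt_iff]; omega

lemma grevlexLt_add_left {a d : Fin 4 →₀ ℕ} (h : grevlexLt a d) (e : Fin 4 →₀ ℕ) :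
    grevlexLt (e + a) (e + d) := by
  rw [grevlexLt_iff] at *
  simp only [Finsupp.add_apply]
  omega

lemma grevlexLt_add_right {a d : Fin 4 →₀ ℕ} (h : grevlexLt a d) (e : Fin 4 →₀ ℕ) :
    grevlexLt (a + e) (d + e) := by
  rw [add_comm a, add_comm d]; exact grevlexLt_add_left h e

lemma grevlexLt_trans {a b c : Fin 4 →₀ ℕ} (h : grevlexLt a b) (h' : grevlexLt b c) :
    grevlexLt a c := by
  rw [grevlexLt_iff] at *
  omega

lemma lead_add_lt {F : Type} [Field F] {f g : MvPolynomial (Fin 4) F} {d e a b : Fin 4 →₀ ℕ}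
    (hf : LeadMonomialIs f d) (hg : LeadMonomialIs g e) (ha : a ∈ f.support)
    (hb : b ∈ g.support) (hne : ¬ (a = d ∧ b = e)) : grevlexLt (a + b) (d + e) := by
  by_cases h1 : a = d
  · by_cases h2 : b = e
    · exact absurd ⟨h1, h2⟩ hne
    · subst h1
      exact grevlexLt_add_left (hg.2 b hb h2) a
  · by_cases h2 : b = e
    · subst h2
      exact grevlexLt_add_right (hf.2 a ha h1) b
    · exact grevlexLt_trans (grevlexLt_add_right (hf.2 a ha h1) b)
        (grevlexLt_add_left (hg.2 b hb h2) d)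

lemma lead_mul {F : Type} [Field F] {f g : MvPolynomial (Fin 4) F} {d e : Fin 4 →₀ ℕ}
    (hf : LeadMonomialIs f d) (hg : LeadMonomialIs g e) : LeadMonomialIs (f * g) (d + e) := by
  classical
  constructor
  · rw [coeff_mul, Finset.sum_eq_single (d, e)]
    · exact mul_ne_zero hf.1 hg.1
    · rintro ⟨a, b⟩ hab hne
      rw [Finset.HasAntidiagonal.mem_antidiagonal] at hab
      simp only at hab ⊢
      by_contra h
      have ha := left_ne_zero_of_mul h
      have hb := right_ne_zero_of_mul h
      have := lead_add_lt hf hg (mem_support_iff.2 ha) (mem_support_iff.2 hb)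
        (fun hh => hne (by rw [hh.1, hh.2]))
      rw [hab] at this
      exact grevlexLt_irrefl _ this
    · intro h
      exfalso
      apply h
      rw [Finset.HasAntidiagonal.mem_antidiagonal]
  · intro c hc hne
    have := support_mul f g hc
    rw [Finset.mem_add] at this
    obtain ⟨a, ha, b, hb, rfl⟩ := this
    exact lead_add_lt hf hg ha hb (fun hh => hne (by rw [hh.1, hh.2]))

lemma lead_one (F : Type) [Field F] : LeadMonomialIs (1 : MvPolynomial (Fin 4) F) 0 := by
  constructor
  · simp
  · intro e he hne
    rw [mem_support_iff, coeff_one] at he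
    exact absurd (by_contra fun h => he (if_neg h)) (Ne.symm hne)

lemma lead_pow {F : Type} [Field F] {f : MvPolynomial (Fin 4) F} {d : Fin 4 →₀ ℕ}
    (hf : LeadMonomialIs f d) (n : ℕ) : LeadMonomialIs (f ^ n) (n • d) := by
  induction n with
  | zero => simpa using lead_one F
  | succ n ih => rw [pow_succ, succ_nsmul]; exact lead_mul ih hf

lemma lead_prod {F : Type} [Field F] {ι : Type} (s : Finset ι) (f : ι → MvPolynomial (Fin 4) F)
    (d : Fin 4 →₀ ℕ) (h : ∀ i ∈ s, LeadMonomialIs (f i) d) :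
    LeadMonomialIs (∏ i ∈ s, f i) (s.card • d) := by
  classical
  induction s using Finset.induction_on with
  | empty => simpa using lead_one F
  | insert a s ha ih =>
    rw [Finset.prod_insert ha, Finset.card_insert_of_notMem ha, succ_nsmul, add_comm]
    exact lead_mul (h a (Finset.mem_insert_self _ _))
      (ih fun i hi => h i (Finset.mem_insert_of_mem hi))

lemma lead_Lform (p : ℕ) [Fact p.Prime] (F : Type) [Field F] [CharP F p] (v : ZMod p × ZMod p)
    (hv : v.1 ≠ 0) : LeadMonomialIs (Lform p F v) (Finsupp.single 3 1) := by
  obtain ⟨c0, c1, c2, h⟩ := Lform_eq p F v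
  have hc : ZMod.castHom (dvd_refl p) F v.1 ≠ 0 := by
    intro h0
    exact hv ((map_eq_zero _).1 h0)
  have hhom := Lform_hom p F v
  constructor
  · rw [h]
    simp only [coeff_add, coeff_C_mul, coeff_X, Finsupp.single_left_inj one_ne_zero]
    simpa using hc
  · intro e he hne
    have hdeg := hhom (mem_support_iff.1 he)
    rw [grevlexLt_iff]
    have hs : e 0 + e 1 + e 2 + e 3 = 1 := by
      rw [Finsupp.weight_apply, Finsupp.sum_fintype _ _ (by simp)] at hdeg
      simpa [Fin.sum_univ_four] using hdeg
    have hne' : ¬ (e 0 = 0 ∧ e 1 = 0 ∧ e 2 = 0) := by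
      rintro ⟨h0, h1, h2⟩
      apply hne
      ext i
      fin_cases i
      · simpa using h0
      · simpa using h1
      · simpa using h2
      · simp; omega
    simp
    omega

lemma lead_dpoly (F : Type) [Field F] : LeadMonomialIs (dpoly F) (Finsupp.single 1 2) := by
  classical
  have hX : (X 2 * X 0 : MvPolynomial (Fin 4) F)
      = monomial (Finsupp.single 2 1 + Finsupp.single 0 1) 1 := by
    simp [X, monomial_mul]
  have hX1 : (X 1 ^ 2 : MvPolynomial (Fin 4) F) = monomial (Finsupp.single 1 2) 1 := by
    rw [X_pow_eq_monomial]
  have hne0 : (Finsupp.single 2 1 + Finsupp.single 0 1 : Fin 4 →₀ ℕ) ≠ Finsupp.single 1 2 := by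
    intro h
    have := DFunLike.congr_fun h 1
    simp at this
  constructor
  · rw [dpoly, hX, hX1, coeff_sub, coeff_monomial, coeff_monomial, if_neg hne0]
    simp
  · intro e he hne
    rw [mem_support_iff, dpoly, hX, hX1, coeff_sub, coeff_monomial, coeff_monomial,
      if_neg (Ne.symm hne)] at he
    have : e = Finsupp.single 2 1 + Finsupp.single 0 1 := by
      by_contra h
      exact he (by rw [if_neg (Ne.symm h), sub_zero])
    rw [this, grevlexLt_iff]
    simp

lemma lead_phi (p : ℕ) [Fact p.Prime] (F : Type) [Field F] [CharP F p] (m : ℕ) :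
    LeadMonomialIs (phi p F m)
      ((Nset p).card • Finsupp.single 3 1 + ((p - 1) * m) • Finsupp.single 1 2) := by
  unfold phi Nprod
  refine lead_mul (lead_prod _ _ _ ?_) (lead_pow (lead_dpoly F) _)
  intro v hv
  refine lead_Lform p F v ?_
  simpa [Nset] using hv

lemma lead_orbSum (p : ℕ) [Fact p.Prime] (F : Type) [Field F] [CharP F p] (m : ℕ) :
    LeadMonomialIs (orbSum p F m)
      ((Nset p).card • Finsupp.single 3 1 + ((p - 1) * m) • Finsupp.single 1 2) := by
  obtain ⟨r, hr⟩ := orbSum_eq p F m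
  have hlead := lead_phi p F m
  have hcoeff : ∀ e : Fin 4 →₀ ℕ, e 0 = 0 →
      coeff e (orbSum p F m) = coeff e (phi p F m) := by
    intro e he
    rw [hr, coeff_add, coeff_X_mul', if_neg, add_zero]
    simpa using he
  constructor
  · rw [hcoeff _ (by simp)]
    exact hlead.1
  · intro e he hne
    by_cases h0 : e 0 = 0
    · refine hlead.2 e ?_ hne
      rw [mem_support_iff, ← hcoeff e h0]
      exact mem_support_iff.1 he
    · have hdeg := orbSum_hom p F m (mem_support_iff.1 he)
      have hs : e 0 + e 1 + e 2 + e 3 = (Nset p).card + 2 * ((p - 1) * m) := by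
        rw [Finsupp.weight_apply, Finsupp.sum_fintype _ _ (by simp)] at hdeg
        simpa [Fin.sum_univ_four] using hdeg
      rw [grevlexLt_iff]
      right
      constructor
      · rw [hs]; simp; ring
      · left; simp; omega

/-! ### No invariant has a power of `a₁` as lead monomial -/

lemma coeff_aeval_single {F : Type} [Field F] (j : Fin 4) (n : ℕ) (f : MvPolynomial (Fin 4) F) :
    (aeval (fun i => if i = j then (Polynomial.X : Polynomial F) else 0) f).coeff n
      = coeff (Finsupp.single j n) f := by
  classical
  induction f using MvPolynomial.induction_on' with
  | add f g hf hg => rw [map_add, Polynomial.coeff_add, hf, hg, coeff_add]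
  | monomial u a =>
    rw [aeval_monomial, coeff_monomial, Finsupp.prod_fintype _ _ (by simp)]
    by_cases hu : ∃ i, i ≠ j ∧ u i ≠ 0
    · obtain ⟨i, hij, hui⟩ := hu
      rw [Finset.prod_eq_zero (Finset.mem_univ i) (by rw [if_neg hij, zero_pow hui]), mul_zero,
        Polynomial.coeff_zero, if_neg]
      intro h
      apply hui
      rw [h, Finsupp.single_eq_of_ne hij]
    · push Not at hu
      have hu' : u = Finsupp.single j (u j) := by
        ext i
        by_cases hij : i = j
        · subst hij; simp
        · rw [hu i hij, Finsupp.single_eq_of_ne hij]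
      rw [Finset.prod_eq_single j (fun i _ hij => by rw [hu i hij, pow_zero]) (by simp),
        if_pos rfl, Polynomial.algebraMap_eq, Polynomial.coeff_C_mul, Polynomial.coeff_X_pow]
      have : (u = Finsupp.single j n) ↔ n = u j := by
        constructor
        · intro h; rw [h]; simp
        · intro h; rw [h]; exact hu'
      simp only [this, mul_ite, mul_one, mul_zero]

lemma lead_not_pow (p : ℕ) [Fact p.Prime] (F : Type) [Field F] [CharP F p]
    (f : MvPolynomial (Fin 4) F) (hf : f ∈ invariants p F) (d : Fin 4 →₀ ℕ)
    (hd : LeadMonomialIs f d) (h0 : d 0 = 0) (h2 : d 2 = 0) (h3 : d 3 = 0) : d 1 = 0 := by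
  by_contra h1
  have hd' : d = Finsupp.single 1 (d 1) := by
    ext i
    fin_cases i <;> simp [h0, h2, h3]
  have hw := hf ⟨!![0, 1; -1, 0], by simp [Matrix.det_fin_two]⟩
  have key : ((aeval (fun i : Fin 4 => if i = 2 then (Polynomial.X : Polynomial F) else 0)).comp
      (act p F !![0, 1; -1, 0]))
      = aeval (fun i : Fin 4 => if i = 1 then (Polynomial.X : Polynomial F) else 0) := by
    apply MvPolynomial.algHom_ext
    intro i
    fin_cases i <;>
      simp [act_X0, act_X1, act_X2, act_X3]
  have hc : coeff (Finsupp.single 2 (d 1)) f = coeff (Finsupp.single 1 (d 1)) f := by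
    rw [← coeff_aeval_single, ← coeff_aeval_single, ← key, AlgHom.comp_apply, hw]
  have hmem : Finsupp.single 2 (d 1) ∈ f.support := by
    rw [mem_support_iff, hc, ← hd']
    exact hd.1
  have := hd.2 _ hmem (by
    intro h
    have := DFunLike.congr_fun h 1
    simp at this
    omega)
  rw [grevlexLt_iff] at this
  simp [h0, h2, h3] at this
  omega

/-! ### Subalgebras defined by support conditions -/

def suppAlg (F : Type) [Field F] (S : AddSubmonoid (Fin 4 →₀ ℕ)) :
    Subalgebra F (MvPolynomial (Fin 4) F) where
  carrier := {f | ∀ e ∈ f.support, e ∈ S}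
  mul_mem' := by
    classical
    intro f g hf hg e he
    have := support_mul f g he
    rw [Finset.mem_add] at this
    obtain ⟨a, ha, b, hb, rfl⟩ := this
    exact S.add_mem (hf a ha) (hg b hb)
  add_mem' := by
    classical
    intro f g hf hg e he
    rcases Finset.mem_union.1 (support_add he) with h | h
    · exact hf e h
    · exact hg e h
  algebraMap_mem' := by
    classical
    intro c e he
    rw [mem_support_iff, algebraMap_eq, coeff_C] at he
    have : 0 = e := by
      by_contra h
      exact he (if_neg h)
    rw [← this]
    exact S.zero_mem

def faceMon : AddSubmonoid (Fin 4 →₀ ℕ) where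
  carrier := {e | e 0 = 0 → e 2 = 0 → e 3 = 0 → e 1 = 0}
  zero_mem' := by intro _ _ _; rfl
  add_mem' := by
    intro a b ha hb
    simp only [Set.mem_ofPred_eq, Finsupp.add_apply] at *
    omega

def coneMon (K : ℕ) : AddSubmonoid (Fin 4 →₀ ℕ) where
  carrier := {e | e 1 ≤ K * (e 0 + e 2 + e 3)}
  zero_mem' := by simp
  add_mem' := by
    intro a b ha hb
    simp only [Set.mem_ofPred_eq, Finsupp.add_apply] at *
    calc a 1 + b 1 ≤ K * (a 0 + a 2 + a 3) + K * (b 0 + b 2 + b 3) := add_le_add ha hb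
      _ = _ := by ring

/-- the lead term algebra of `F[V]^{SL₂(F_p)}` — the `F`-subalgebra of
`F[V]` generated by the lead monomials (grevlex order, `a₀ < a₁ < a₂ < a₃`) of the nonzero
invariants — is not a finitely generated `F`-algebra; equivalently, `F[V]^{SL₂(F_p)}` has
no finite SAGBI basis with respect to this order. -/
theorem no_finite_sagbi (p : ℕ) [Fact p.Prime] (hp : 3 < p)
    (F : Type) [Field F] [CharP F p] :
    ¬ (Algebra.adjoin F {g : MvPolynomial (Fin 4) F |
        ∃ f ∈ invariants p F, f ≠ 0 ∧ ∃ d : Fin 4 →₀ ℕ,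
          LeadMonomialIs f d ∧ g = monomial d 1}).FG := by
  rintro ⟨T, hT⟩
  have hface : Algebra.adjoin F {g : MvPolynomial (Fin 4) F |
        ∃ f ∈ invariants p F, f ≠ 0 ∧ ∃ d : Fin 4 →₀ ℕ,
          LeadMonomialIs f d ∧ g = monomial d 1} ≤ suppAlg F faceMon := by
    refine Algebra.adjoin_le ?_
    rintro g ⟨f, hf, _, d, hd, rfl⟩ e he
    have : e = d := Finset.mem_singleton.1 (support_monomial_subset he)
    rw [this]
    exact fun h0 h2 h3 => lead_not_pow p F f hf d hd h0 h2 h3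
  let K : ℕ := T.sup (fun f => f.support.sup (fun e => e 1))
  have hcone : Algebra.adjoin F (T : Set (MvPolynomial (Fin 4) F)) ≤ suppAlg F (coneMon K) := by
    refine Algebra.adjoin_le ?_
    intro f hf e he
    have h1 : e 1 ≤ K :=
      le_trans (Finset.le_sup (f := fun e : Fin 4 →₀ ℕ => e 1) he)
        (Finset.le_sup (f := fun f : MvPolynomial (Fin 4) F => f.support.sup (fun e => e 1)) hf)
    have h2 : e ∈ faceMon := by
      have : f ∈ suppAlg F faceMon := hface (hT ▸ Algebra.subset_adjoin hf)
      exact this e he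
    change e 1 ≤ K * (e 0 + e 2 + e 3)
    by_cases h : e 0 + e 2 + e 3 = 0
    · have : e 1 = 0 := h2 (by omega) (by omega) (by omega)
      omega
    · exact le_trans h1 (Nat.le_mul_of_pos_right K (Nat.pos_of_ne_zero h))
  let m : ℕ := K * (Nset p).card + 1
  let D : Fin 4 →₀ ℕ := (Nset p).card • Finsupp.single 3 1 + ((p - 1) * m) • Finsupp.single 1 2
  have hlead : LeadMonomialIs (orbSum p F m) D := lead_orbSum p F m
  have hmem : monomial D (1 : F) ∈ suppAlg F (coneMon K) := by
    apply hcone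
    rw [hT]
    refine Algebra.subset_adjoin ⟨orbSum p F m, orbSum_mem p F m, ?_, D, hlead, rfl⟩
    intro h
    apply hlead.1
    rw [h, coeff_zero]
  have hD : D ∈ coneMon K := by
    refine hmem D ?_
    rw [mem_support_iff, coeff_monomial, if_pos rfl]
    exact one_ne_zero
  have hD' : D 1 ≤ K * (D 0 + D 2 + D 3) := hD
  have e1 : D 1 = (p - 1) * m * 2 := by simp [D]
  have e0 : D 0 + D 2 + D 3 = (Nset p).card := by simp [D]
  rw [e1, e0] at hD'
  have : m ≤ (p - 1) * m := Nat.le_mul_of_pos_left m (by omega)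
  have hm : m = K * (Nset p).card + 1 := rfl
  omega

end
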